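/- The image of the energy–momentum map EM : ℝ⁴ → ℝ², (x, y) ↦ (E(x, y), L(x, y)), is exactly the set {(e, ℓ) ∈ ℝ² : |ℓ| ≤ e}. -/

import Mathlib

/-! Statement 2: The image of the energy–momentum map
`EM : ℝ⁴ → ℝ², (x, y) ↦ (E(x, y), L(x, y))` is exactly `{(e, ℓ) ∈ ℝ² : |ℓ| ≤ e}`.

A point of ℝ⁴ is modelled as `v = (x₁, x₂, y₁, y₂)`, i.e.
`v.1 = x₁`, `v.2.1 = x₂`, `v.2.2.1 = y₁`, `v.2.2.2 = y₂`. -/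

/-- The energy–momentum map of the 2-dimensional harmonic oscillator. -/
noncomputable def energyMomentumMap (v : ℝ × ℝ × ℝ × ℝ) : ℝ × ℝ :=
  ((v.1 ^ 2 + v.2.2.1 ^ 2) / 2 + (v.2.1 ^ 2 + v.2.2.2 ^ 2) / 2,
    v.1 * v.2.2.2 - v.2.1 * v.2.2.1)

theorem range_energyMomentumMap :
    Set.range energyMomentumMap = {p : ℝ × ℝ | |p.2| ≤ p.1} := by
  ext ⟨e, l⟩
  simp only [Set.mem_range, Set.mem_ofPred_eq]
  constructor
  · rintro ⟨⟨x₁, x₂, y₁, y₂⟩, h⟩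
    simp only [energyMomentumMap, Prod.mk.injEq] at h
    obtain ⟨rfl, rfl⟩ := h
    rw [abs_le]
    constructor
    · nlinarith [sq_nonneg (x₁ + y₂), sq_nonneg (x₂ - y₁)]
    · nlinarith [sq_nonneg (x₁ - y₂), sq_nonneg (x₂ + y₁)]
  · intro h
    obtain ⟨hl, hr⟩ := abs_le.mp h
    have hs : √(2 * (e + l)) ^ 2 = 2 * (e + l) := Real.sq_sqrt (by linarith)
    have ht : √(2 * (e - l)) ^ 2 = 2 * (e - l) := Real.sq_sqrt (by linarith)
    refine ⟨((√(2 * (e + l)) + √(2 * (e - l))) / 2, 0, 0,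
      (√(2 * (e + l)) - √(2 * (e - l))) / 2), ?_⟩
    simp only [energyMomentumMap, Prod.mk.injEq]
    constructor
    · linear_combination (hs + ht) / 4
    · linear_combination (hs - ht) / 4
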